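/- For integers 0 < q < p, ∫₀¹ (t^{q-1} - t^{p-q-1})/(1 - t^p) dt = (π/p)·cot(qπ/p). -/

import Mathlib

open Filter Topology

/-- Mittag-Leffler expansion of the cotangent on `(0, 1)`, with the poles paired as
`k` and `-(k + 1)`. -/
lemma Real.tendsto_sum_pi_mul_cot {x : ℝ} (hx0 : 0 < x) (hx1 : x < 1) :
    Tendsto (fun N : ℕ ↦ ∑ k ∈ Finset.range N, (1 / (x + k) - 1 / (k + 1 - x))) atTop
      (𝓝 (Real.pi * Real.cot (Real.pi * x))) := by
  have hmem : (x : ℂ) ∈ Complex.integerComplement := by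
    rintro ⟨n, hn⟩
    have hn' : (n : ℝ) = x := by exact_mod_cast hn
    rw [← hn'] at hx0 hx1
    have h0 : 0 < n := by exact_mod_cast hx0
    have h1 : n < 1 := by exact_mod_cast hx1
    omega
  have hseries := tendsto_logDeriv_euler_cot_sub hmem
  have hreal : Tendsto (fun N : ℕ ↦ ∑ k ∈ Finset.range N, (1 / (x - (k + 1)) + 1 / (x + (k + 1))))
      atTop (𝓝 (Real.pi * Real.cot (Real.pi * x) - 1 / x)) := by
    have hre := (Complex.continuous_re.tendsto _).comp hseries
    convert hre using 1
    · ext N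
      simp only [Function.comp_apply, cotTerm]
      rw [← Complex.ofReal_re (∑ k ∈ Finset.range N, (1 / (x - (k + 1)) + 1 / (x + (k + 1))))]
      push_cast
      rfl
    · rw [← Complex.ofReal_re (Real.pi * Real.cot (Real.pi * x) - 1 / x)]
      push_cast
      rfl
  have htail : Tendsto (fun N : ℕ ↦ 1 / (x + N)) atTop (𝓝 0) := by
    simp only [one_div]
    exact tendsto_inv_atTop_zero.comp
      (tendsto_atTop_add_const_left _ _ tendsto_natCast_atTop_atTop)
  have hlim := (hreal.add_const (1 / x)).sub htail
  rw [sub_add_cancel, sub_zero] at hlim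
  refine hlim.congr fun N ↦ ?_
  induction N with
  | zero => simp
  | succ N ih =>
    rw [Finset.sum_range_succ, Finset.sum_range_succ, ← ih]
    have hneg : 1 / (x - ((N : ℝ) + 1)) = -(1 / (N + 1 - x)) := by
      rw [← neg_sub, one_div_neg_eq_neg_one_div]
    rw [hneg]
    push_cast
    ring

/-- After cancelling `1 - t`, the quotient is continuous on `[0, 1]`. -/
lemma intervalIntegrable_pow_sub_pow_div_one_sub_pow (a b : ℕ) {p : ℕ} (hp : 0 < p) :
    IntervalIntegrable (fun t : ℝ ↦ (t ^ a - t ^ b) / (1 - t ^ p)) MeasureTheory.volume 0 1 := by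
  have hcont : ContinuousOn (fun t : ℝ ↦
      (∑ i ∈ Finset.range b, t ^ i - ∑ i ∈ Finset.range a, t ^ i) / ∑ i ∈ Finset.range p, t ^ i)
      (Set.uIcc 0 1) := by
    refine ContinuousOn.div (by fun_prop) (by fun_prop) fun t ht ↦ ?_
    rw [Set.uIcc_of_le zero_le_one] at ht
    exact (geom_sum_pos ht.1 hp.ne').ne'
  refine hcont.intervalIntegrable.congr_ae ?_
  refine MeasureTheory.ae_restrict_of_ae ?_
  filter_upwards [MeasureTheory.Measure.ae_ne MeasureTheory.volume (1 : ℝ)] with t ht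
  have hne : (1 : ℝ) - t ≠ 0 := sub_ne_zero.mpr ht.symm
  have hnum : t ^ a - t ^ b =
      (1 - t) * (∑ i ∈ Finset.range b, t ^ i - ∑ i ∈ Finset.range a, t ^ i) := by
    rw [mul_sub, mul_neg_geom_sum, mul_neg_geom_sum]
    ring
  rw [hnum, ← mul_neg_geom_sum t p, mul_div_mul_left _ _ hne]

lemma tendsto_sum_integral_pow_sub_pow_div_one_sub_pow (a b : ℕ) {p : ℕ} (hp : 0 < p) :
    Tendsto (fun N : ℕ ↦ ∑ k ∈ Finset.range N,
        (1 / ((p : ℝ) * k + a + 1) - 1 / ((p : ℝ) * k + b + 1))) atTop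
      (𝓝 (∫ t in (0 : ℝ)..1, (t ^ a - t ^ b) / (1 - t ^ p))) := by
  have hint := intervalIntegrable_pow_sub_pow_div_one_sub_pow a b hp
  have hsum (N : ℕ) : ∑ k ∈ Finset.range N,
      (1 / ((p : ℝ) * k + a + 1) - 1 / ((p : ℝ) * k + b + 1)) =
      ∫ t in (0 : ℝ)..1, ∑ k ∈ Finset.range N, (t ^ (p * k + a) - t ^ (p * k + b)) := by
    rw [intervalIntegral.integral_finsetSum fun k _ ↦
      (by fun_prop : Continuous fun t : ℝ ↦ t ^ (p * k + a) - t ^ (p * k + b)).intervalIntegrable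
        _ _]
    refine Finset.sum_congr rfl fun k _ ↦ ?_
    rw [intervalIntegral.integral_sub (by simp) (by simp), integral_pow, integral_pow]
    simp
  simp only [hsum]
  have hae : ∀ᵐ t : ℝ, t ∈ Set.uIoc 0 1 → t ∈ Set.Ioo (0 : ℝ) 1 := by
    filter_upwards [MeasureTheory.Measure.ae_ne MeasureTheory.volume (1 : ℝ)] with t ht htm
    rw [Set.uIoc_of_le zero_le_one] at htm
    exact ⟨htm.1, lt_of_le_of_ne htm.2 ht⟩
  have hpartial {t : ℝ} (ht : t ∈ Set.Ioo (0 : ℝ) 1) (N : ℕ) :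
      ∑ k ∈ Finset.range N, (t ^ (p * k + a) - t ^ (p * k + b)) =
        (t ^ a - t ^ b) / (1 - t ^ p) * (1 - (t ^ p) ^ N) := by
    have hne : 1 - t ^ p ≠ 0 := (sub_pos.mpr (pow_lt_one₀ ht.1.le ht.2 hp.ne')).ne'
    rw [← mul_neg_geom_sum (t ^ p) N, ← mul_assoc, div_mul_cancel₀ _ hne, Finset.mul_sum]
    refine Finset.sum_congr rfl fun k _ ↦ ?_
    ring
  refine intervalIntegral.tendsto_integral_filter_of_dominated_convergence
    (fun t ↦ ‖(t ^ a - t ^ b) / (1 - t ^ p)‖) ?_ ?_ hint.norm ?_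
  · exact Eventually.of_forall fun N ↦
      (by fun_prop : Continuous fun t : ℝ ↦
        ∑ k ∈ Finset.range N, (t ^ (p * k + a) - t ^ (p * k + b))).aestronglyMeasurable
  · refine Eventually.of_forall fun N ↦ ?_
    filter_upwards [hae] with t ht htm
    have hpow0 : 0 ≤ (t ^ p) ^ N := pow_nonneg (pow_nonneg (ht htm).1.le _) _
    have hpow1 : (t ^ p) ^ N ≤ 1 :=
      pow_le_one₀ (pow_nonneg (ht htm).1.le _) (pow_le_one₀ (ht htm).1.le (ht htm).2.le)
    rw [hpartial (ht htm), norm_mul]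
    refine mul_le_of_le_one_right (norm_nonneg _) ?_
    rw [Real.norm_eq_abs, abs_le]
    constructor <;> linarith
  · filter_upwards [hae] with t ht htm
    simp only [hpartial (ht htm)]
    have hpow := tendsto_pow_atTop_nhds_zero_of_lt_one (pow_nonneg (ht htm).1.le p)
      (pow_lt_one₀ (ht htm).1.le (ht htm).2 hp.ne')
    simpa using (hpow.const_sub 1).const_mul ((t ^ a - t ^ b) / (1 - t ^ p))

theorem integral_cot (p q : ℕ) (h0 : 0 < q) (hqp : q < p) :
    ∫ t in (0 : ℝ)..1, (t ^ (q - 1) - t ^ (p - q - 1)) / (1 - t ^ p) =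
      (Real.pi / p) * Real.cot (q * Real.pi / p) := by
  have hp : 0 < p := h0.trans hqp
  have hpR : (0 : ℝ) < p := by exact_mod_cast hp
  have hqR : (0 : ℝ) < q := by exact_mod_cast h0
  have hqpR : (q : ℝ) < p := by exact_mod_cast hqp
  have hcot := (Real.tendsto_sum_pi_mul_cot (div_pos hqR hpR)
    ((div_lt_one hpR).mpr hqpR)).const_mul (1 / (p : ℝ))
  have hval : (Real.pi / p) * Real.cot (q * Real.pi / p) =
      1 / (p : ℝ) * (Real.pi * Real.cot (Real.pi * (q / p))) := by
    rw [show Real.pi * ((q : ℝ) / p) = q * Real.pi / p by ring]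
    ring
  rw [hval]
  refine tendsto_nhds_unique
    (tendsto_sum_integral_pow_sub_pow_div_one_sub_pow (q - 1) (p - q - 1) hp)
    (hcot.congr fun N ↦ ?_)
  rw [Finset.mul_sum]
  refine Finset.sum_congr rfl fun k _ ↦ ?_
  rw [Nat.cast_sub (by omega : 1 ≤ p - q), Nat.cast_sub hqp.le, Nat.cast_sub h0, mul_sub,
    one_div_mul_one_div, one_div_mul_one_div]
  congr 2 <;> · push_cast; field_simp; ring
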